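/- Let M_τ, A_τ ∈ ℝ^{N_t×N_t} with M_τ invertible, M_h, A_h ∈ ℝ^{N_x×N_x}, α ∈ ℝ^{N_t}, and set r := e_{N_t}ᵀ M_τ⁻¹ ∈ ℝ^{1×N_t} and S := M_τ ⊗ A_h + (A_τ M_τ⁻¹ A_τ) ⊗ M_h. Suppose p_0, q_0 ∈ ℝ^{N_x}, f_1, …, f_c ∈ ℝ^{N_t·N_x}, and (u_j, v_j) ∈ ℝ^{N_t·N_x} × ℝ^{N_t·N_x} for j = 1, …, c satisfy, with p_j := u_j^{N_t} and q_j := v_j^{N_t} for j ≥ 1, the coupled step equations (M_τ ⊗ I_{N_x}) v_j = (A_τ ⊗ I_{N_x}) u_j − α ⊗ p_{j-1} and (A_τ ⊗ M_h) v_j + (M_τ ⊗ A_h) u_j = (M_τ ⊗ M_h) f_j + α ⊗ (M_h q_{j-1}). Then, with B := (α (r A_τ) + (A_τ M_τ⁻¹ α) e_{N_t}ᵀ) ⊗ M_h, the stacked displacements satisfy a block lower-triangular system with two nonzero subdiagonals: S u_1 = (M_τ ⊗ M_h) f_1 + α ⊗ (M_h q_0) + (A_τ M_τ⁻¹ α)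 ⊗ (M_h p_0); S u_2 = (M_τ ⊗ M_h) f_2 + B u_1 − (r α) · (α ⊗ (M_h p_0)); and for every j = 3, …, c: S u_j = (M_τ ⊗ M_h) f_j + B u_{j-1} − (r α) · (α ⊗ (M_h u_{j-2}^{N_t})). Here r α = e_{N_t}ᵀ M_τ⁻¹ α is a scalar and r A_τ ∈ ℝ^{1×N_t} a row vector. -/

import Mathlib

open Matrix Kronecker

/-- Kronecker product `a ⊗ w` of a temporal vector `a ∈ ℝ^{N_t}` and a spatial vector
`w ∈ ℝ^{N_x}`, viewed as a stacked space-time vector whose `i`-th block is `a i • w`. -/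
def vkron {m n : ℕ} (a : Fin m → ℝ) (w : Fin n → ℝ) : Fin m × Fin n → ℝ :=
  fun p => a p.1 * w p.2

/-- The last temporal index. -/
def lastIdx (m : ℕ) (h : 0 < m) : Fin m := ⟨m - 1, Nat.sub_lt h Nat.one_pos⟩

/-- The last temporal block `u^{N_t}` of a stacked space-time vector. -/
def lastBlock {m n : ℕ} (h : 0 < m) (u : Fin m × Fin n → ℝ) : Fin n → ℝ :=
  fun x => u (lastIdx m h, x)

/-- Contraction `∑ i, b i • u^i` of the temporal index of a stacked space-time vector `u`
against a temporal vector `b`. -/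
def temporalContract {m n : ℕ} (b : Fin m → ℝ) (u : Fin m × Fin n → ℝ) : Fin n → ℝ :=
  fun x => ∑ i, b i * u (i, x)

lemma kronecker_mulVec_vkron {m n : ℕ} (P : Matrix (Fin m) (Fin m) ℝ)
    (Q : Matrix (Fin n) (Fin n) ℝ) (a : Fin m → ℝ) (w : Fin n → ℝ) :
    (P ⊗ₖ Q) *ᵥ vkron a w = vkron (P *ᵥ a) (Q *ᵥ w) := by
  ext ⟨i, x⟩
  simp only [mulVec, dotProduct, vkron, kroneckerMap_apply, Fintype.sum_prod_type,
    Finset.sum_mul_sum]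
  exact Finset.sum_congr rfl fun _ _ => Finset.sum_congr rfl fun _ _ => by ring

lemma vecMulVec_kronecker_mulVec {m n : ℕ} (a b : Fin m → ℝ) (Q : Matrix (Fin n) (Fin n) ℝ)
    (u : Fin m × Fin n → ℝ) :
    (vecMulVec a b ⊗ₖ Q) *ᵥ u = vkron a (Q *ᵥ temporalContract b u) := by
  ext ⟨i, x⟩
  simp only [mulVec, dotProduct, vkron, temporalContract, kroneckerMap_apply, vecMulVec_apply,
    Fintype.sum_prod_type_right, Finset.mul_sum]
  exact Finset.sum_congr rfl fun _ _ => Finset.sum_congr rfl fun _ _ => by ring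

lemma vkron_sub {m n : ℕ} (a : Fin m → ℝ) (w z : Fin n → ℝ) :
    vkron a (w - z) = vkron a w - vkron a z := by
  ext
  simp [vkron, mul_sub]

lemma vkron_smul {m n : ℕ} (a : Fin m → ℝ) (s : ℝ) (w : Fin n → ℝ) :
    vkron a (s • w) = s • vkron a w := by
  ext
  simp [vkron, mul_left_comm]

lemma temporalContract_single {m n : ℕ} (h : 0 < m) (u : Fin m × Fin n → ℝ) :
    temporalContract (Pi.single (lastIdx m h) 1) u = lastBlock h u := by
  ext
  simp [temporalContract, lastBlock, Pi.single_apply]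

lemma temporalContract_sub {m n : ℕ} (b : Fin m → ℝ) (u z : Fin m × Fin n → ℝ) :
    temporalContract b (u - z) = temporalContract b u - temporalContract b z := by
  ext
  simp [temporalContract, mul_sub]

lemma temporalContract_vkron {m n : ℕ} (b a : Fin m → ℝ) (w : Fin n → ℝ) :
    temporalContract b (vkron a w) = (b ⬝ᵥ a) • w := by
  ext
  simp [temporalContract, vkron, dotProduct, Finset.sum_mul, mul_assoc]

lemma temporalContract_kronecker_one_mulVec {m n : ℕ} (b : Fin m → ℝ)
    (P : Matrix (Fin m) (Fin m) ℝ) (u : Fin m × Fin n → ℝ) :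
    temporalContract b ((P ⊗ₖ (1 : Matrix (Fin n) (Fin n) ℝ)) *ᵥ u)
      = temporalContract (b ᵥ* P) u := by
  ext x
  simp only [temporalContract, mulVec, vecMul, dotProduct, kroneckerMap_apply, one_apply,
    Fintype.sum_prod_type, mul_ite, mul_one, mul_zero, ite_mul, zero_mul, Finset.sum_ite_eq,
    Finset.mem_univ, if_true, Finset.mul_sum, Finset.sum_mul]
  rw [Finset.sum_comm]
  exact Finset.sum_congr rfl fun _ _ => Finset.sum_congr rfl fun _ _ => by ring

/-- Derivation of the all-at-once system for `c` consecutive time steps of the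
CG(p)–DG(k) discretization of the acoustic wave equation (paper eqs. (15)–(16)):
eliminating the velocities yields a block lower-triangular system for the displacements
with diagonal block `S = M_τ ⊗ A_h + (A_τ M_τ⁻¹ A_τ) ⊗ M_h` and two nonzero subdiagonal
block bands. -/
theorem allAtOnce_wave_dg
    (Nt Nx c : ℕ) (hNt : 0 < Nt) (hc : 0 < c)
    (Mτ Aτ : Matrix (Fin Nt) (Fin Nt) ℝ) (hMτ : IsUnit Mτ.det)
    (Mh Ah : Matrix (Fin Nx) (Fin Nx) ℝ)
    (α : Fin Nt → ℝ)
    (u v f : ℕ → Fin Nt × Fin Nx → ℝ)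
    (p q : ℕ → Fin Nx → ℝ)
    (hp : ∀ j, 1 ≤ j → p j = lastBlock hNt (u j))
    (hq : ∀ j, 1 ≤ j → q j = lastBlock hNt (v j))
    (hstep : ∀ j, 1 ≤ j → j ≤ c →
      (Mτ ⊗ₖ (1 : Matrix (Fin Nx) (Fin Nx) ℝ)) *ᵥ v j
          = (Aτ ⊗ₖ (1 : Matrix (Fin Nx) (Fin Nx) ℝ)) *ᵥ u j - vkron α (p (j - 1)) ∧
        (Aτ ⊗ₖ Mh) *ᵥ v j + (Mτ ⊗ₖ Ah) *ᵥ u j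
          = (Mτ ⊗ₖ Mh) *ᵥ f j + vkron α (Mh *ᵥ q (j - 1))) :
    let e : Fin Nt → ℝ := Pi.single (lastIdx Nt hNt) 1
    let r : Fin Nt → ℝ := e ᵥ* Mτ⁻¹
    let S : Matrix (Fin Nt × Fin Nx) (Fin Nt × Fin Nx) ℝ :=
      Mτ ⊗ₖ Ah + (Aτ * Mτ⁻¹ * Aτ) ⊗ₖ Mh
    let B : Matrix (Fin Nt × Fin Nx) (Fin Nt × Fin Nx) ℝ :=
      (vecMulVec α (r ᵥ* Aτ) + vecMulVec ((Aτ * Mτ⁻¹) *ᵥ α) e) ⊗ₖ Mh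
    (S *ᵥ u 1
        = (Mτ ⊗ₖ Mh) *ᵥ f 1 + vkron α (Mh *ᵥ q 0)
          + vkron ((Aτ * Mτ⁻¹) *ᵥ α) (Mh *ᵥ p 0)) ∧
    (2 ≤ c →
      S *ᵥ u 2
        = (Mτ ⊗ₖ Mh) *ᵥ f 2 + B *ᵥ u 1 - (r ⬝ᵥ α) • vkron α (Mh *ᵥ p 0)) ∧
    (∀ j, 3 ≤ j → j ≤ c →
      S *ᵥ u j
        = (Mτ ⊗ₖ Mh) *ᵥ f j + B *ᵥ u (j - 1)
          - (r ⬝ᵥ α) • vkron α (Mh *ᵥ lastBlock hNt (u (j - 2)))) := by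
  intro e r S B
  have hinv : Mτ⁻¹ * Mτ = 1 := nonsing_inv_mul Mτ hMτ
  have hSu : ∀ j, 1 ≤ j → j ≤ c → S *ᵥ u j
      = (Mτ ⊗ₖ Mh) *ᵥ f j + vkron α (Mh *ᵥ q (j - 1))
        + vkron ((Aτ * Mτ⁻¹) *ᵥ α) (Mh *ᵥ p (j - 1)) := by
    intro j hj hjc
    obtain ⟨hvel, hdisp⟩ := hstep j hj hjc
    have hv := congrArg (((Aτ * Mτ⁻¹) ⊗ₖ Mh) *ᵥ ·) hvel
    simp only [mulVec_sub, mulVec_mulVec, ← mul_kronecker_mul, mul_one, kronecker_mulVec_vkron,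
      mul_assoc Aτ Mτ⁻¹ Mτ, hinv] at hv
    rw [add_mulVec, ← hdisp, hv]
    abel
  have hqj : ∀ j, 1 ≤ j → j ≤ c →
      q j = temporalContract (r ᵥ* Aτ) (u j) - (r ⬝ᵥ α) • p (j - 1) := by
    intro j hj hjc
    have hrM : r ᵥ* Mτ = e := by rw [vecMul_vecMul, hinv, vecMul_one]
    have hqe : q j = temporalContract e (v j) := by rw [hq j hj, temporalContract_single]
    rw [hqe, ← hrM, ← temporalContract_kronecker_one_mulVec,
      (hstep j hj hjc).1, temporalContract_sub, temporalContract_vkron,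
      temporalContract_kronecker_one_mulVec]
  have hB : ∀ j, B *ᵥ u j = vkron α (Mh *ᵥ temporalContract (r ᵥ* Aτ) (u j))
      + vkron ((Aτ * Mτ⁻¹) *ᵥ α) (Mh *ᵥ lastBlock hNt (u j)) := by
    intro j
    unfold B
    rw [add_kronecker, add_mulVec, vecMulVec_kronecker_mulVec, vecMulVec_kronecker_mulVec,
      ← temporalContract_single]
  have hrec : ∀ j, 2 ≤ j → j ≤ c → S *ᵥ u j
      = (Mτ ⊗ₖ Mh) *ᵥ f j + B *ᵥ u (j - 1)
        - (r ⬝ᵥ α) • vkron α (Mh *ᵥ p (j - 2)) := by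
    intro j hj hjc
    rw [hSu j (by lia) hjc, hqj (j - 1) (by lia) (by lia), hp (j - 1) (by lia), hB, mulVec_sub,
      mulVec_smul, vkron_sub, vkron_smul, Nat.sub_sub]
    abel
  refine ⟨hSu 1 le_rfl hc, hrec 2 le_rfl, fun j hj hjc => ?_⟩
  rw [hrec j (by lia) hjc, hp (j - 2) (by lia)]
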